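/- Let N = ⟨A, ■, ♦⟩ be a □-regular modal Nelson lattice. Then: (i) if a² ≤ b then (■a)² ≤ ■b; (ii) if (∼a)² ≤ ∼b then (∼■a)² ≤ ∼■b. -/

import Mathlib

/-- A Nelson (residuated) lattice: a bounded lattice with a commutative monoid
operation `mul` (unit `⊤`) residuated by `imp`, which is involutive
(`∼∼a = a` where `∼a = a ⇒ ⊥`) and satisfies the Nelson identity
`((a² ⇒ b) ⊓ ((∼b)² ⇒ ∼a)) ⇒ (a ⇒ b) = ⊤`. -/
structure NelsonStruct (A : Type*) [Lattice A] [BoundedOrder A] where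
  mul : A → A → A
  imp : A → A → A
  mul_comm : ∀ a b, mul a b = mul b a
  mul_assoc : ∀ a b c, mul (mul a b) c = mul a (mul b c)
  top_mul : ∀ a, mul ⊤ a = a
  res : ∀ a b c, mul a b ≤ c ↔ b ≤ imp a c
  involutive : ∀ a, imp (imp a ⊥) ⊥ = a
  nelson : ∀ a b,
    imp ((imp (mul a a) b) ⊓
         (imp (mul (imp b ⊥) (imp b ⊥)) (imp a ⊥))) (imp a b) = ⊤

namespace NelsonStruct

variable {A : Type*} [Lattice A] [BoundedOrder A] (N : NelsonStruct A)

/-- The square `a² = a * a`. -/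
def sq (a : A) : A := N.mul a a

/-- The strong negation `∼a = a ⇒ ⊥`. -/
def sneg (a : A) : A := N.imp a ⊥

end NelsonStruct

namespace NelsonStruct

variable {A : Type*} [Lattice A] [BoundedOrder A] (N : NelsonStruct A)

theorem mul_top (a : A) : N.mul a ⊤ = a := by
  rw [N.mul_comm, N.top_mul]

theorem mul_le_mul_left {b c : A} (h : b ≤ c) (a : A) : N.mul a b ≤ N.mul a c :=
  (N.res a b _).2 (h.trans ((N.res a c _).1 le_rfl))

theorem mul_le_mul {a b c d : A} (h : a ≤ b) (k : c ≤ d) : N.mul a c ≤ N.mul b d := by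
  refine (N.mul_le_mul_left k a).trans ?_
  rw [N.mul_comm a, N.mul_comm b]
  exact N.mul_le_mul_left h d

theorem sq_mono {a b : A} (h : a ≤ b) : N.sq a ≤ N.sq b :=
  N.mul_le_mul h h

theorem mul_le_left (a b : A) : N.mul a b ≤ a :=
  (N.mul_le_mul_left le_top a).trans_eq (N.mul_top a)

theorem sq_le (a : A) : N.sq a ≤ a :=
  N.mul_le_left a a

theorem le_sneg_iff {a b : A} : b ≤ N.sneg a ↔ N.mul a b ≤ ⊥ :=
  (N.res a b ⊥).symm

theorem sneg_sneg (a : A) : N.sneg (N.sneg a) = a :=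
  N.involutive a

theorem le_sneg_comm {a b : A} : b ≤ N.sneg a ↔ a ≤ N.sneg b := by
  rw [le_sneg_iff, le_sneg_iff, N.mul_comm]

theorem sneg_anti {a b : A} (h : a ≤ b) : N.sneg b ≤ N.sneg a :=
  N.le_sneg_comm.1 (h.trans_eq (N.sneg_sneg b).symm)

theorem sneg_inf_sneg (a b : A) : N.sneg a ⊓ N.sneg b = N.sneg (a ⊔ b) := by
  apply le_antisymm
  · exact N.le_sneg_comm.1 (sup_le (N.le_sneg_comm.1 inf_le_left) (N.le_sneg_comm.1 inf_le_right))
  · exact le_inf (N.sneg_anti le_sup_left) (N.sneg_anti le_sup_right)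

theorem top_le_imp_iff {a b : A} : ⊤ ≤ N.imp a b ↔ a ≤ b := by
  rw [← N.res, N.mul_top]

/-- The Nelson identity as a quasi-identity. -/
theorem le_of_sq_le {a b : A} (h : N.sq a ≤ b) (k : N.sq (N.sneg b) ≤ N.sneg a) : a ≤ b :=
  N.top_le_imp_iff.1 <|
    (le_inf (N.top_le_imp_iff.2 h) (N.top_le_imp_iff.2 k)).trans
      (N.top_le_imp_iff.1 (N.nelson a b).ge)

/-- Nelson lattices are three-potent. -/
theorem sq_le_mul_sq (a : A) : N.sq a ≤ N.mul a (N.sq a) := by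
  have : Std.Commutative N.mul := ⟨N.mul_comm⟩
  have : Std.Associative N.mul := ⟨N.mul_assoc⟩
  set c := N.mul a (N.sq a) with hc
  have hbot : N.mul c (N.sneg c) ≤ ⊥ := N.le_sneg_iff.1 le_rfl
  have key : a ≤ N.sneg (N.mul a (N.sneg c)) := by
    apply N.le_of_sq_le
    · rw [le_sneg_iff]
      refine le_trans (le_of_eq ?_) hbot
      generalize N.sneg c = e
      simp only [hc, sq]
      ac_rfl
    · rw [sneg_sneg, le_sneg_iff]
      refine le_trans (le_of_eq ?_) ((N.mul_le_left _ (N.sneg c)).trans hbot)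
      generalize N.sneg c = e
      simp only [hc, sq]
      ac_rfl
  rw [le_sneg_iff] at key
  rw [← N.sneg_sneg c, le_sneg_iff]
  refine le_trans (le_of_eq ?_) key
  generalize N.sneg c = e
  simp only [sq]
  ac_rfl

theorem sq_sq (a : A) : N.sq (N.sq a) = N.sq a := by
  refine le_antisymm (N.sq_le _) ?_
  have h := N.sq_le_mul_sq a
  refine h.trans ((N.mul_le_mul_left h a).trans_eq ?_)
  simp only [sq, N.mul_assoc]

theorem sq_inf_of_sq_le {a b : A} (h : N.sq a ≤ b) : N.sq (a ⊓ b) = N.sq a :=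
  le_antisymm (N.sq_mono inf_le_left)
    ((N.sq_sq a).ge.trans (N.sq_mono (le_inf (N.sq_le a) h)))

end NelsonStruct

/-- In a `□`-regular modal Nelson lattice:
(i) if `a² ≤ b` then `(■a)² ≤ ■b`;
(ii) if `(∼a)² ≤ ∼b` then `(∼■a)² ≤ ∼■b`. -/
theorem NelsonStruct.box_monotonicity {A : Type*} [Lattice A] [BoundedOrder A]
    (N : NelsonStruct A) (box dia : A → A)
    (hdia : ∀ a, dia a = N.sneg (box (N.sneg a)))
    (hcompat : ∀ a b, N.sq a = N.sq b →
        N.sq (box a) = N.sq (box b) ∧ N.sq (dia a) = N.sq (dia b))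
    (hreg : ∀ a b, box (a ⊓ b) = box a ⊓ box b) (a b : A) :
    (N.sq a ≤ b → N.sq (box a) ≤ box b) ∧
    (N.sq (N.sneg a) ≤ N.sneg b → N.sq (N.sneg (box a)) ≤ N.sneg (box b)) := by
  have hmono : Monotone box := fun x y h => by
    rw [← inf_eq_left.2 h, hreg]
    exact inf_le_right
  refine ⟨fun h => ?_, fun h => ?_⟩
  · rw [← (hcompat _ _ (N.sq_inf_of_sq_le h)).1, hreg]
    exact (N.sq_le _).trans inf_le_right
  · have key := (hcompat _ _ (N.sq_inf_of_sq_le h)).2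
    rw [N.sneg_inf_sneg, hdia, hdia, N.sneg_sneg, N.sneg_sneg] at key
    rw [← key]
    exact (N.sq_le _).trans (N.sneg_anti (hmono le_sup_right))
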